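/- arXiv:1508.05594 — 3 statements merged into one kernel-verified Lean document; each statement's English description precedes it below -/
import Mathlib

section
/- Let V be a finite-dimensional real vector space, F^max ⊆ V a strictly convex finitely generated cone, and E^max ⊆ V a nonempty polyhedron that contains no affine line and whose recession cone equals F^max. Suppose Deep : Set V → Set V → Prop is a predicate ('B is F-deep', for subsets B ⊆ V and faces F of F^max) satisfying: (i) if Deep B F holds and w ∈ F, then Deep (B + {w}) F holds (Minkowski translate); (ii) for every B that is a nonempty finite union of polytopes and every face F of F^max there exists v ∈ F with Deep (B + {v}) F; (iii) Deep B {0} holds for every B. Then there exist a finite set 𝔉 of faces of F^max and, for each F ∈ 𝔉, a nonempty subset B_F ⊆ V that is a finite union of polytopes, such that Deep B_F F holds for every F ∈ 𝔉 and E^max = ⋃_{F ∈ 𝔉} (B_F + F), where B_F + F denotes the Minkowski sum. -/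
open Set Pointwise

namespace Stmt0

variable {V : Type*} [AddCommGroup V] [Module ℝ V]

/-- A polytope: the convex hull of a finite set. -/
def IsPolytope (B : Set V) : Prop :=
  ∃ s : Finset V, B = convexHull ℝ (s : Set V)

/-- A finite union of polytopes. -/
def IsFiniteUnionOfPolytopes (B : Set V) : Prop :=
  ∃ ps : Finset (Set V), (∀ P ∈ ps, IsPolytope P) ∧ B = ⋃ P ∈ ps, P

/-- A finitely generated cone: all nonnegative combinations of finitely many vectors. -/
def IsFGCone (C : Set V) : Prop :=
  ∃ s : Finset V,
    C = {x | ∃ a : V → ℝ, (∀ v, 0 ≤ a v) ∧ x = ∑ v ∈ s, a v • v}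

/-- A face of a cone `C`: the intersection of `C` with the kernel of a linear
functional that is nonnegative on `C`. -/
def IsConeFace (C F : Set V) : Prop :=
  ∃ ℓ : V →ₗ[ℝ] ℝ, (∀ x ∈ C, 0 ≤ ℓ x) ∧ F = C ∩ {x | ℓ x = 0}

/-- A polyhedron: a finite intersection of affine half-spaces. -/
def IsPolyhedron (E : Set V) : Prop :=
  ∃ s : Finset ((V →ₗ[ℝ] ℝ) × ℝ), E = {x | ∀ p ∈ s, 0 ≤ p.1 x + p.2}

/-- The recession cone of a set `E`. -/
def recCone (E : Set V) : Set V :=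
  {v | ∀ x ∈ E, ∀ t : ℝ, 0 ≤ t → x + t • v ∈ E}

/-- `E` contains no affine line. -/
def ContainsNoAffineLine (E : Set V) : Prop :=
  ¬ ∃ a v : V, v ≠ 0 ∧ ∀ t : ℝ, a + t • v ∈ E

section Polytopes

theorem IsPolytope.isFiniteUnionOfPolytopes {P : Set V} (hP : IsPolytope P) :
    IsFiniteUnionOfPolytopes P :=
  ⟨{P}, by simpa using hP, by simp⟩

theorem IsFiniteUnionOfPolytopes.union {A B : Set V} (hA : IsFiniteUnionOfPolytopes A)
    (hB : IsFiniteUnionOfPolytopes B) : IsFiniteUnionOfPolytopes (A ∪ B) := by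
  classical
  obtain ⟨ps, hps, rfl⟩ := hA
  obtain ⟨qs, hqs, rfl⟩ := hB
  refine ⟨ps ∪ qs, fun P hP => ?_, by rw [Finset.set_biUnion_union]⟩
  rcases Finset.mem_union.1 hP with h | h
  exacts [hps P h, hqs P h]

theorem IsPolytope.add {P Q : Set V} (hP : IsPolytope P) (hQ : IsPolytope Q) :
    IsPolytope (P + Q) := by
  classical
  obtain ⟨s, rfl⟩ := hP
  obtain ⟨t, rfl⟩ := hQ
  exact ⟨s + t, by rw [Finset.coe_add, convexHull_add]⟩

theorem IsFiniteUnionOfPolytopes.add {A B : Set V} (hA : IsFiniteUnionOfPolytopes A)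
    (hB : IsFiniteUnionOfPolytopes B) : IsFiniteUnionOfPolytopes (A + B) := by
  classical
  obtain ⟨ps, hps, rfl⟩ := hA
  obtain ⟨qs, hqs, rfl⟩ := hB
  refine ⟨Finset.image₂ (· + ·) ps qs, fun P hP => ?_, ?_⟩
  · obtain ⟨p, hp, q, hq, rfl⟩ := Finset.mem_image₂.1 hP
    exact (hps p hp).add (hqs q hq)
  · ext x
    simp only [Set.mem_add, mem_iUnion, Finset.mem_image₂, exists_prop]
    constructor
    · rintro ⟨a, ⟨p, hp, ha⟩, b, ⟨q, hq, hb⟩, rfl⟩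
      exact ⟨p + q, ⟨p, hp, q, hq, rfl⟩, Set.add_mem_add ha hb⟩
    · rintro ⟨_, ⟨p, hp, q, hq, rfl⟩, hx⟩
      obtain ⟨a, ha, b, hb, rfl⟩ := Set.mem_add.1 hx
      exact ⟨a, ⟨p, hp, ha⟩, b, ⟨q, hq, hb⟩, rfl⟩

theorem isPolytope_singleton (v : V) : IsPolytope ({v} : Set V) :=
  ⟨{v}, by simp⟩

/-- The zonotope `{∑ u ∈ S, b u • u | 0 ≤ b u ≤ M}`. -/
def zonotope (S : Finset V) (M : ℝ) : Set V :=
  ∑ u ∈ S, convexHull ℝ {0, M • u}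

theorem isPolytope_zonotope (S : Finset V) (M : ℝ) : IsPolytope (zonotope S M) := by
  classical
  refine ⟨∑ u ∈ S, {0, M • u}, ?_⟩
  rw [Finset.coe_sum, convexHull_sum, zonotope]
  simp

theorem sum_smul_mem_zonotope {S : Finset V} {M : ℝ} {b : V → ℝ}
    (hb : ∀ u ∈ S, 0 ≤ b u ∧ b u ≤ M) : ∑ u ∈ S, b u • u ∈ zonotope S M := by
  refine Set.finsetSum_mem_finsetSum _ _ _ fun u hu => ?_
  obtain ⟨h0, h1⟩ := hb u hu
  rw [convexHull_pair]
  rcases h0.trans h1 |>.eq_or_lt with hM | hM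
  · have : b u = 0 := le_antisymm (hM ▸ h1) h0
    rw [this, zero_smul]
    exact left_mem_segment _ _ _
  · refine ⟨1 - b u / M, b u / M, ?_, by positivity, by ring, ?_⟩
    · rw [sub_nonneg, div_le_one hM]; exact h1
    · rw [smul_zero, zero_add, smul_smul, div_mul_cancel₀ _ hM.ne']

end Polytopes

section Polyhedra

variable {s : Finset ((V →ₗ[ℝ] ℝ) × ℝ)}

theorem recCone_eq (hne : {x : V | ∀ p ∈ s, 0 ≤ p.1 x + p.2}.Nonempty) :
    recCone {x : V | ∀ p ∈ s, 0 ≤ p.1 x + p.2} = {w | ∀ p ∈ s, 0 ≤ p.1 w} := by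
  ext w
  constructor
  · intro hw p hp
    obtain ⟨x, hx⟩ := hne
    by_contra! hneg
    have hxp := hx p hp
    have h := hw x hx ((p.1 x + p.2 + 1) / (-p.1 w)) (by
      apply div_nonneg <;> linarith) p hp
    have hne : -p.1 w ≠ 0 := by linarith
    have hmul : (p.1 x + p.2 + 1) / (-p.1 w) * (-p.1 w) = p.1 x + p.2 + 1 :=
      div_mul_cancel₀ _ hne
    simp only [map_add, map_smul, smul_eq_mul] at h
    linarith
  · intro hw x hx t ht p hp
    have h1 := mul_nonneg ht (hw p hp)
    have h2 := hx p hp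
    simp only [map_add, map_smul, smul_eq_mul]
    linarith

/-- The constraints of a system of affine inequalities that are not active at `x`. -/
noncomputable def inactive (s : Finset ((V →ₗ[ℝ] ℝ) × ℝ)) (x : V) :
    Finset ((V →ₗ[ℝ] ℝ) × ℝ) := by
  classical exact s.filter fun p => p.1 x + p.2 ≠ 0

theorem mem_inactive {x : V} {p : (V →ₗ[ℝ] ℝ) × ℝ} :
    p ∈ inactive s x ↔ p ∈ s ∧ p.1 x + p.2 ≠ 0 := by
  simp [inactive]

/-- Moving from a point of a polyhedron in a direction along which the active constraints are
constant, and which is not a recession direction, one hits a new constraint. -/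
theorem exists_inactive_ssubset {x v : V} (hx : ∀ p ∈ s, 0 ≤ p.1 x + p.2)
    (hv : ∀ p ∈ s, p.1 x + p.2 = 0 → p.1 v = 0) (hvK : ¬ ∀ p ∈ s, 0 ≤ p.1 v) :
    ∃ t : ℝ, 0 < t ∧ (∀ p ∈ s, 0 ≤ p.1 (x + t • v) + p.2) ∧
      inactive s (x + t • v) ⊂ inactive s x := by
  classical
  push Not at hvK
  obtain ⟨p₀, hp₀, hp₀v⟩ := hvK
  obtain ⟨q, hq, hmin⟩ := Finset.exists_min_image (s.filter fun p => p.1 v < 0)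
    (fun p => (p.1 x + p.2) / (-p.1 v)) ⟨p₀, Finset.mem_filter.2 ⟨hp₀, hp₀v⟩⟩
  obtain ⟨hqs, hqv⟩ := Finset.mem_filter.1 hq
  have hqx : 0 < q.1 x + q.2 := (hx q hqs).lt_of_ne' fun h => hqv.ne (hv q hqs h)
  set t := (q.1 x + q.2) / (-q.1 v)
  have htpos : 0 < t := div_pos hqx (by linarith)
  have htq : t * (-q.1 v) = q.1 x + q.2 := div_mul_cancel₀ _ (by linarith)
  refine ⟨t, htpos, fun p hp => ?_, ?_⟩
  · simp only [map_add, map_smul, smul_eq_mul]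
    rcases le_or_gt 0 (p.1 v) with h | h
    · have h1 := mul_nonneg htpos.le h
      have h2 := hx p hp
      linarith
    · have h1 := hmin p (Finset.mem_filter.2 ⟨hp, h⟩)
      have h2 := (le_div_iff₀ (by linarith : 0 < -p.1 v)).1 h1
      linarith
  · refine (Finset.ssubset_iff_of_subset fun p hp => ?_).2 ⟨q, ?_, ?_⟩
    · rw [mem_inactive] at hp ⊢
      refine ⟨hp.1, fun h => hp.2 ?_⟩
      simp only [map_add, map_smul, hv p hp.1 h, smul_zero, add_zero, h]
    · exact mem_inactive.2 ⟨hqs, hqx.ne'⟩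
    · rw [mem_inactive]
      rintro ⟨-, h⟩
      apply h
      simp only [map_add, map_smul, smul_eq_mul]
      linarith

/-- A line-free polyhedron is the sum of a polytope and its recession cone. -/
theorem exists_eq_convexHull_add
    (hline : ContainsNoAffineLine {x : V | ∀ p ∈ s, 0 ≤ p.1 x + p.2}) :
    ∃ W : Finset V, {x : V | ∀ p ∈ s, 0 ≤ p.1 x + p.2} =
      convexHull ℝ (W : Set V) + {w | ∀ p ∈ s, 0 ≤ p.1 w} := by
  classical
  have hKconv : Convex ℝ {w : V | ∀ p ∈ s, 0 ≤ p.1 w} := by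
    intro x hx y hy a b ha hb _ p hp
    simp only [map_add, map_smul, smul_eq_mul]
    exact add_nonneg (mul_nonneg ha (hx p hp)) (mul_nonneg hb (hy p hp))
  have hEconv : Convex ℝ {x : V | ∀ p ∈ s, 0 ≤ p.1 x + p.2} := by
    intro x hx y hy a b ha hb hab p hp
    have h := add_nonneg (mul_nonneg ha (hx p hp)) (mul_nonneg hb (hy p hp))
    have hc : p.2 = (a + b) * p.2 := by rw [hab, one_mul]
    simp only [map_add, map_smul, smul_eq_mul]
    linarith
  let W : Set V := {x | (∀ p ∈ s, 0 ≤ p.1 x + p.2) ∧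
    ∀ v, (∀ p ∈ s, p.1 x + p.2 = 0 → p.1 v = 0) → v = 0}
  have hWfin : W.Finite := by
    refine Set.Finite.of_injOn (f := inactive s) (t := (s.powerset : Set _)) ?_ ?_
      (Finset.finite_toSet _)
    · intro x _
      exact Finset.mem_coe.2 (Finset.mem_powerset.2 fun p hp => (mem_inactive.1 hp).1)
    · intro x hx y _ hxy
      refine (sub_eq_zero.1 (hx.2 (y - x) fun p hp h => ?_)).symm
      have hy : p.1 y + p.2 = 0 := by
        by_contra hne
        exact (mem_inactive.1 (hxy ▸ mem_inactive.2 ⟨hp, hne⟩ : p ∈ inactive s x)).2 h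
      rw [map_sub]
      linarith
  refine ⟨hWfin.toFinset, ?_⟩
  rw [Set.Finite.coe_toFinset]
  apply Set.Subset.antisymm
  · suffices H : ∀ (A : Finset ((V →ₗ[ℝ] ℝ) × ℝ)) (x : V), inactive s x = A →
        (∀ p ∈ s, 0 ≤ p.1 x + p.2) → x ∈ convexHull ℝ W + {w | ∀ p ∈ s, 0 ≤ p.1 w} from
      fun x hx => H _ x rfl hx
    intro A
    induction A using Finset.strongInduction with
    | H A ih =>
    rintro x rfl hx
    by_cases hxW : x ∈ W
    · exact ⟨x, subset_convexHull ℝ _ hxW, 0, by simp, add_zero x⟩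
    obtain ⟨v, hv, hv0⟩ : ∃ v, (∀ p ∈ s, p.1 x + p.2 = 0 → p.1 v = 0) ∧ v ≠ 0 := by
      by_contra! h
      exact hxW ⟨hx, h⟩
    have one_sided : ∀ v : V, (∀ p ∈ s, p.1 x + p.2 = 0 → p.1 v = 0) →
        (¬ ∀ p ∈ s, 0 ≤ p.1 v) → (∀ p ∈ s, 0 ≤ p.1 (-v)) →
        x ∈ convexHull ℝ W + {w | ∀ p ∈ s, 0 ≤ p.1 w} := by
      intro v hv hvK hvK'
      obtain ⟨t, ht, htE, hlt⟩ := exists_inactive_ssubset hx hv hvK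
      obtain ⟨a, ha, w, hw, haw⟩ := ih _ hlt _ rfl htE
      refine ⟨a, ha, w + t • (-v), fun p hp => ?_, ?_⟩
      · rw [map_add, map_smul, smul_eq_mul]
        exact add_nonneg (hw p hp) (mul_nonneg ht.le (hvK' p hp))
      · have haw' : a + w = x + t • v := haw
        change a + (w + t • (-v)) = x
        rw [← add_assoc, haw', smul_neg, add_neg_cancel_right]
    have hv' : ∀ p ∈ s, p.1 x + p.2 = 0 → p.1 (-v) = 0 := fun p hp h => by
      rw [map_neg, hv p hp h, neg_zero]
    by_cases h1 : ∀ p ∈ s, 0 ≤ p.1 v <;> by_cases h2 : ∀ p ∈ s, 0 ≤ p.1 (-v)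
    · refine (hline ⟨x, v, hv0, fun t p hp => ?_⟩).elim
      have h3 := h1 p hp
      have h4 := h2 p hp
      rw [map_neg] at h4
      have h5 : p.1 v = 0 := by linarith
      simpa [h5] using hx p hp
    · exact one_sided (-v) hv' h2 (by simpa using h1)
    · exact one_sided v hv h1 h2
    · obtain ⟨t, ht, htE, hlt⟩ := exists_inactive_ssubset hx hv h1
      obtain ⟨r, hr, hrE, hlr⟩ := exists_inactive_ssubset hx hv' h2
      have hst : 0 < t + r := add_pos ht hr
      have hconv := (convex_convexHull ℝ W).add hKconv
      have := hconv (ih _ hlt _ rfl htE) (ih _ hlr _ rfl hrE)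
        (div_pos hr hst).le (div_pos ht hst).le (by field_simp; ring)
      convert this using 1
      match_scalars
      · field_simp
        ring
      · field_simp
        ring
  · rintro _ ⟨a, ha, w, hw, rfl⟩ p hp
    have h1 := convexHull_min (fun x hx => hx.1) hEconv ha p hp
    have h2 := hw p hp
    simp only [map_add]
    linarith

end Polyhedra

section Cones

theorem IsConeFace.add_mem {C F : Set V} (hC : ∀ x ∈ C, ∀ y ∈ C, x + y ∈ C)
    (hF : IsConeFace C F) {x y : V} (hx : x ∈ F) (hy : y ∈ F) : x + y ∈ F := by
  obtain ⟨ℓ, -, rfl⟩ := hF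
  refine ⟨hC x hx.1 y hy.1, ?_⟩
  have h1 : ℓ x = 0 := hx.2
  have h2 : ℓ y = 0 := hy.2
  simp [h1, h2]

/-- Given a point `v` of a face `F` of a finitely generated cone cut out by the functionals in `s`,
the part of `F` not in `v + F` is covered by translates, by points of a polytope, of the
proper faces of `F` cut out by single functionals in `s`. -/
theorem exists_polytope_cover {s : Finset ((V →ₗ[ℝ] ℝ) × ℝ)} {C F : Set V}
    (hC : C = {w | ∀ p ∈ s, 0 ≤ p.1 w}) (hgen : IsFGCone C) (hF : IsConeFace C F)
    {v : V} (hv : v ∈ F) :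
    ∃ R : Set V, IsPolytope R ∧ R.Nonempty ∧ R ⊆ F ∧
      ∀ x ∈ F, (x - v ∈ F) ∨ ∃ p ∈ s, 0 < p.1 v ∧ x ∈ R + (F ∩ {y | p.1 y = 0}) := by
  classical
  obtain ⟨S, hS⟩ := hgen
  obtain ⟨ℓ, hℓ, hFℓ⟩ := hF
  have hFC : ∀ {x}, x ∈ F → x ∈ C := fun hx => (hFℓ ▸ hx : _ ∈ C ∩ {x | ℓ x = 0}).1
  have hFker : ∀ {x}, x ∈ F → ℓ x = 0 := fun hx => (hFℓ ▸ hx : _ ∈ C ∩ {x | ℓ x = 0}).2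
  have hFmk : ∀ {x}, x ∈ C → ℓ x = 0 → x ∈ F := fun h1 h2 => by rw [hFℓ]; exact ⟨h1, h2⟩
  have hCp : ∀ {x}, x ∈ C → ∀ p ∈ s, 0 ≤ p.1 x := fun hx => by rw [hC] at hx; exact hx
  have hCmk : ∀ {x}, (∀ p ∈ s, 0 ≤ p.1 x) → x ∈ C := fun hx => by rw [hC]; exact hx
  have hF0 : (0 : V) ∈ F := hFmk (hCmk (by simp)) (map_zero ℓ)
  have hFadd : ∀ x y, x ∈ F → y ∈ F → x + y ∈ F := fun x y hx hy => by
    refine hFmk (hCmk fun p hp => ?_) ?_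
    · rw [map_add]; exact add_nonneg (hCp (hFC hx) p hp) (hCp (hFC hy) p hp)
    · rw [map_add, hFker hx, hFker hy, add_zero]
  have hFsmul : ∀ (a : ℝ) x, 0 ≤ a → x ∈ F → a • x ∈ F := fun a x ha hx => by
    refine hFmk (hCmk fun p hp => ?_) ?_
    · rw [map_smul]; exact mul_nonneg ha (hCp (hFC hx) p hp)
    · rw [map_smul, hFker hx, smul_zero]
  have hSC : ∀ u ∈ S, u ∈ C := fun u hu => by
    rw [hS]
    exact ⟨fun w => if w = u then 1 else 0, fun w => by positivity, by simp [hu]⟩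
  let T := S.filter (· ∈ F)
  obtain ⟨M', hM'⟩ := ((s ×ˢ T).image fun z => z.1.1 v / z.1.1 z.2).exists_le
  let M := max M' 0
  have hM0 : 0 ≤ M := le_max_right _ _
  have hM : ∀ p ∈ s, ∀ u ∈ T, p.1 v / p.1 u ≤ M := fun p hp u hu =>
    (hM' _ (Finset.mem_image.2 ⟨(p, u), Finset.mem_product.2 ⟨hp, hu⟩, rfl⟩)).trans
      (le_max_left _ _)
  refine ⟨zonotope T M, isPolytope_zonotope T M, ?_, ?_, fun x hx => ?_⟩
  · exact ⟨_, sum_smul_mem_zonotope (b := fun _ => 0) fun _ _ => ⟨le_rfl, hM0⟩⟩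
  · intro x hx
    obtain ⟨g, hg, rfl⟩ := (Set.mem_finsetSum _ _ _).1 hx
    refine Finset.sum_induction g (· ∈ F) hFadd hF0 fun u hu => ?_
    have h := hg hu
    rw [convexHull_pair] at h
    obtain ⟨a, b, -, hb, -, hab⟩ := h
    rw [← hab, smul_zero, zero_add]
    exact hFsmul b _ hb (hFsmul M _ hM0 (Finset.mem_filter.1 hu).2)
  by_cases hxv : x - v ∈ F
  · exact Or.inl hxv
  right
  obtain ⟨p, hp, hpneg⟩ : ∃ p ∈ s, p.1 (x - v) < 0 := by
    by_contra! h
    exact hxv (hFmk (hCmk h) (by rw [map_sub, hFker hx, hFker hv, sub_zero]))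
  rw [map_sub] at hpneg
  have hpx := hCp (hFC hx) p hp
  refine ⟨p, hp, by linarith, ?_⟩
  obtain ⟨a, ha, hxa⟩ : ∃ a : V → ℝ, (∀ u, 0 ≤ a u) ∧ x = ∑ u ∈ S, a u • u := by
    have := hFC hx
    rwa [hS] at this
  have haF : ∀ u ∈ S, u ∉ F → a u = 0 := by
    have h0 : ∑ u ∈ S, a u * ℓ u = 0 := by
      have := hFker hx
      rw [hxa, map_sum] at this
      simpa using this
    intro u hu huF
    have := (Finset.sum_eq_zero_iff_of_nonneg fun u hu =>
      mul_nonneg (ha u) (hℓ u (hSC u hu))).1 h0 u hu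
    exact (mul_eq_zero.1 this).resolve_right fun h => huF (hFmk (hSC u hu) h)
  have hxT : x = ∑ u ∈ T, a u • u := by
    rw [hxa, Finset.sum_filter_of_ne]
    intro u hu hne
    by_contra huF
    exact hne (by rw [haF u hu huF, zero_smul])
  have hpT : ∀ u ∈ T, 0 ≤ p.1 u := fun u hu => hCp (hFC (Finset.mem_filter.1 hu).2) p hp
  have hle : ∀ u ∈ T, a u * p.1 u ≤ p.1 v := fun u hu => by
    have h1 : p.1 x = ∑ u ∈ T, a u * p.1 u := by
      conv_lhs => rw [hxT, map_sum]
      simp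
    have h2 := Finset.single_le_sum (f := fun u => a u * p.1 u)
      (fun u hu => mul_nonneg (ha u) (hpT u hu)) hu
    exact h2.trans (h1 ▸ (sub_neg.1 hpneg).le)
  refine ⟨∑ u ∈ T, (if p.1 u = 0 then 0 else a u) • u, ?_,
    ∑ u ∈ T, (if p.1 u = 0 then a u else 0) • u, ?_, ?_⟩
  · refine sum_smul_mem_zonotope fun u hu => ?_
    split_ifs with h
    · exact ⟨le_rfl, hM0⟩
    · have hpos : 0 < p.1 u := (hpT u hu).lt_of_ne' h
      exact ⟨ha u, ((le_div_iff₀ hpos).2 (hle u hu)).trans (hM p hp u hu)⟩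
  · constructor
    · refine Finset.sum_induction _ (· ∈ F) hFadd hF0 fun u hu => ?_
      refine hFsmul _ _ ?_ (Finset.mem_filter.1 hu).2
      split_ifs
      exacts [ha u, le_rfl]
    · change p.1 _ = 0
      rw [map_sum]
      refine Finset.sum_eq_zero fun u _ => ?_
      split_ifs with h <;> simp [h]
  · change _ + _ = x
    rw [← Finset.sum_add_distrib, hxT]
    refine Finset.sum_congr rfl fun u _ => ?_
    split_ifs <;> simp

/-- The faces cut out by subsets of a finite system of functionals defining a cone. -/
theorem exists_finset_faces (s : Finset ((V →ₗ[ℝ] ℝ) × ℝ)) {C : Set V}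
    (hC : C = {w | ∀ p ∈ s, 0 ≤ p.1 w}) :
    ∃ Φ : Finset (Set V), C ∈ Φ ∧ (∀ F ∈ Φ, IsConeFace C F) ∧
      ∀ F ∈ Φ, ∀ p ∈ s, F ∩ {y | p.1 y = 0} ∈ Φ := by
  classical
  refine ⟨s.powerset.image fun T => C ∩ {y | ∀ p ∈ T, p.1 y = 0}, ?_, ?_, ?_⟩
  · exact Finset.mem_image.2 ⟨∅, by simp, by simp⟩
  · intro F hF
    obtain ⟨T, hT, rfl⟩ := Finset.mem_image.1 hF
    rw [Finset.mem_powerset] at hT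
    have hnonneg : ∀ x ∈ C, ∀ p ∈ T, 0 ≤ p.1 x := fun x hx p hp => by
      rw [hC] at hx; exact hx p (hT hp)
    refine ⟨∑ p ∈ T, p.1, fun x hx => ?_, ?_⟩
    · rw [LinearMap.sum_apply]
      exact Finset.sum_nonneg (hnonneg x hx)
    · ext x
      simp only [mem_inter_iff, mem_ofPred_eq, LinearMap.sum_apply]
      exact and_congr_right fun hx =>
        (Finset.sum_eq_zero_iff_of_nonneg (hnonneg x hx)).symm
  · intro F hF p hp
    obtain ⟨T, hT, rfl⟩ := Finset.mem_image.1 hF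
    rw [Finset.mem_powerset] at hT
    refine Finset.mem_image.2 ⟨insert p T,
      Finset.mem_powerset.2 (Finset.insert_subset hp hT), ?_⟩
    ext x
    simp only [mem_inter_iff, mem_ofPred_eq, Finset.forall_mem_insert]
    tauto

end Cones

/-- Cellular decomposition of a polyhedron with recession cone `Fmax` into pieces of the
form `B_F + F`, with each `B_F` an `F`-deep finite union of polytopes. -/
theorem cellular_decomposition [FiniteDimensional ℝ V]
    (Fmax : Set V) (hFgen : IsFGCone Fmax) (hFstrict : Fmax ∩ (-Fmax) = {0})
    (Emax : Set V) (hEpoly : IsPolyhedron Emax) (hEne : Emax.Nonempty)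
    (hEline : ContainsNoAffineLine Emax) (hErec : recCone Emax = Fmax)
    (Deep : Set V → Set V → Prop)
    (hDeep₁ : ∀ (B F : Set V) (w : V), IsConeFace Fmax F → Deep B F → w ∈ F →
      Deep (B + {w}) F)
    (hDeep₂ : ∀ B F : Set V, B.Nonempty → IsFiniteUnionOfPolytopes B →
      IsConeFace Fmax F → ∃ v ∈ F, Deep (B + {v}) F)
    (hDeep₃ : ∀ B : Set V, Deep B ({0} : Set V)) :
    ∃ (𝔉 : Finset (Set V)) (B : Set V → Set V),
      (∀ F ∈ 𝔉, IsConeFace Fmax F) ∧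
      (∀ F ∈ 𝔉, (B F).Nonempty ∧ IsFiniteUnionOfPolytopes (B F) ∧ Deep (B F) F) ∧
      Emax = ⋃ F ∈ 𝔉, (B F + F) := by
  classical
  obtain ⟨s, hs⟩ := hEpoly
  have hFmax : Fmax = {w | ∀ p ∈ s, 0 ≤ p.1 w} := by
    rw [← hErec, hs, recCone_eq (hs ▸ hEne)]
  obtain ⟨W, hW⟩ := exists_eq_convexHull_add (hs ▸ hEline)
  rw [← hs, ← hFmax] at hW
  obtain ⟨Φ, hΦmax, hΦface, hΦinter⟩ := exists_finset_faces s hFmax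
  have hFmax_add : ∀ x ∈ Fmax, ∀ y ∈ Fmax, x + y ∈ Fmax := by
    rw [hFmax]
    intro x hx y hy p hp
    rw [map_add]
    exact add_nonneg (hx p hp) (hy p hp)
  -- Translate the pieces one face at a time, always treating a maximal face of `U`.
  suffices H : ∀ (U : Finset (Set V)), U ⊆ Φ → (∀ F ∈ U, ∀ G ∈ Φ, G ⊂ F → G ∈ U) →
      ∀ B : Set V → Set V,
        (∀ F ∈ Φ, (B F).Nonempty ∧ IsFiniteUnionOfPolytopes (B F)) →
        (∀ F ∈ Φ, F ∉ U → Deep (B F) F) → Emax = ⋃ F ∈ Φ, (B F + F) →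
        ∃ B' : Set V → Set V,
          (∀ F ∈ Φ, (B' F).Nonempty ∧ IsFiniteUnionOfPolytopes (B' F) ∧ Deep (B' F) F) ∧
          Emax = ⋃ F ∈ Φ, (B' F + F) by
    have hWne : (convexHull ℝ (W : Set V)).Nonempty := by
      rw [hW] at hEne
      exact hEne.of_add_left
    obtain ⟨B, hB, hE⟩ := H Φ subset_rfl (fun _ _ G hG _ => hG) (fun _ => convexHull ℝ (W : Set V))
      (fun _ _ => ⟨hWne, IsPolytope.isFiniteUnionOfPolytopes ⟨W, rfl⟩⟩)
      (fun F hF hF' => (hF' hF).elim) (by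
        refine Set.Subset.antisymm ?_ (iUnion₂_subset fun F hF => ?_)
        · rw [hW]
          exact subset_biUnion_of_mem (u := fun F => convexHull ℝ (W : Set V) + F) hΦmax
        · obtain ⟨ℓ, -, rfl⟩ := hΦface F hF
          rw [hW]
          exact Set.add_subset_add_left inter_subset_left)
    exact ⟨Φ, B, hΦface, hB, hE⟩
  intro U
  induction U using Finset.strongInduction with
  | H U ih =>
  intro hUΦ hUlow B hB hDeep hE
  rcases U.eq_empty_or_nonempty with rfl | hUne
  · exact ⟨B, fun F hF => ⟨(hB F hF).1, (hB F hF).2, hDeep F hF (by simp)⟩, hE⟩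
  obtain ⟨F, hFU, hFmaxl⟩ := U.exists_maximal hUne
  have hFΦ := hUΦ hFU
  have hFface := hΦface F hFΦ
  obtain ⟨v, hvF, hv⟩ := hDeep₂ (B F) F (hB F hFΦ).1 (hB F hFΦ).2 hFface
  obtain ⟨R, hR, hRne, hRF, hcover⟩ := exists_polytope_cover hFmax hFgen hFface hvF
  let B' : Set V → Set V := fun G =>
    if G = F then B F + {v} else if G ⊂ F then B G ∪ (B F + R) else B G
  have hB'F : B' F = B F + {v} := if_pos rfl
  have hB'lt : ∀ {G}, G ⊂ F → B' G = B G ∪ (B F + R) := fun h => by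
    simp only [B', if_neg h.ne, if_pos h]
  have hB'not : ∀ {G}, G ≠ F → ¬ G ⊂ F → B' G = B G := fun h1 h2 => by
    simp only [B', if_neg h1, if_neg h2]
  have hBF_sub : B F + F ⊆ Emax := by
    rw [hE]
    exact subset_biUnion_of_mem (u := fun F => B F + F) hFΦ
  refine ih (U.erase F) (Finset.erase_ssubset hFU) ((Finset.erase_subset _ _).trans hUΦ) ?_ B'
    ?_ ?_ ?_
  · intro G hG H hH hHG
    obtain ⟨hGF, hGU⟩ := Finset.mem_erase.1 hG
    refine Finset.mem_erase.2 ⟨?_, hUlow G hGU H hH hHG⟩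
    rintro rfl
    exact hHG.not_subset (hFmaxl hGU hHG.subset)
  · intro G hG
    rcases eq_or_ne G F with rfl | hGF
    · rw [hB'F]
      exact ⟨(hB G hG).1.add (singleton_nonempty v),
        (hB G hG).2.add (isPolytope_singleton v).isFiniteUnionOfPolytopes⟩
    by_cases hlt : G ⊂ F
    · rw [hB'lt hlt]
      exact ⟨(hB G hG).1.inl, (hB G hG).2.union ((hB F hFΦ).2.add hR.isFiniteUnionOfPolytopes)⟩
    · rw [hB'not hGF hlt]
      exact hB G hG
  · intro G hG hGU
    rcases eq_or_ne G F with rfl | hGF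
    · rwa [hB'F]
    have hGU' : G ∉ U := fun h => hGU (Finset.mem_erase.2 ⟨hGF, h⟩)
    rw [hB'not hGF fun hlt => hGU' (hUlow F hFU G hG hlt)]
    exact hDeep G hG hGU'
  · apply Set.Subset.antisymm
    · intro x hx
      rw [hE] at hx
      obtain ⟨G, hG, b, hb, g, hg, rfl⟩ := mem_iUnion₂.1 hx
      rw [mem_iUnion₂]
      rcases eq_or_ne G F with rfl | hGF
      · rcases hcover g hg with h | ⟨p, hp, hpv, r, hr, y, hy, rfl⟩
        · refine ⟨G, hG, b + v, ?_, g - v, h, by simp⟩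
          rw [hB'F]
          exact Set.add_mem_add hb rfl
        · have hlt : G ∩ {y | p.1 y = 0} ⊂ G :=
            ⟨inter_subset_left, fun h => hpv.ne' (h hvF).2⟩
          refine ⟨_, hΦinter G hG p hp, b + r, ?_, y, hy, add_assoc _ _ _⟩
          rw [hB'lt hlt]
          exact Or.inr (Set.add_mem_add hb hr)
      · refine ⟨G, hG, b, ?_, g, hg, rfl⟩
        by_cases hlt : G ⊂ F
        · rw [hB'lt hlt]
          exact Or.inl hb
        · rwa [hB'not hGF hlt]
    · have hBG_sub : ∀ G ∈ Φ, B G + G ⊆ Emax := fun G hG => by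
        rw [hE]
        exact subset_biUnion_of_mem (u := fun F => B F + F) hG
      refine iUnion₂_subset fun G hG => ?_
      rcases eq_or_ne G F with rfl | hGF
      · rw [hB'F]
        rintro _ ⟨_, ⟨b, hb, w, hw, rfl⟩, g, hg, rfl⟩
        have hwG : w ∈ G := mem_singleton_iff.1 hw ▸ hvF
        exact hBF_sub ⟨b, hb, w + g, hFface.add_mem hFmax_add hwG hg, (add_assoc _ _ _).symm⟩
      by_cases hlt : G ⊂ F
      · rw [hB'lt hlt, Set.union_add]
        refine union_subset (hBG_sub G hG) ?_
        rintro _ ⟨_, ⟨b, hb, r, hr, rfl⟩, g, hg, rfl⟩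
        exact hBF_sub ⟨b, hb, r + g, hFface.add_mem hFmax_add (hRF hr) (hlt.subset hg),
          (add_assoc _ _ _).symm⟩
      · rw [hB'not hGF hlt]
        exact hBG_sub G hG

end Stmt0
end

section
/- Let V be a finite-dimensional real vector space, B ⊆ V a nonempty compact subset, and C ⊆ V a finitely generated convex cone (the set of nonnegative combinations of finitely many fixed vectors; in particular 0 ∈ C and C is closed). Then the recession cone of the Minkowski sum B + C equals C: {v ∈ V : (B + C) + ℝ≥0·v ⊆ B + C} = C. Consequently, in any decomposition E = B + C of a polyhedron E with B nonempty compact and C a finitely generated cone, C is necessarily the recession cone of E. -/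
open Set Pointwise

namespace Stmt5

variable {V : Type*} [NormedAddCommGroup V] [NormedSpace ℝ V] [FiniteDimensional ℝ V]

/-- A finitely generated cone: all nonnegative combinations of finitely many vectors. -/
def IsFGCone (C : Set V) : Prop :=
  ∃ s : Finset V,
    C = {x | ∃ a : V → ℝ, (∀ v, 0 ≤ a v) ∧ x = ∑ v ∈ s, a v • v}

/-- A polyhedron: a finite intersection of affine half-spaces. -/
def IsPolyhedron (E : Set V) : Prop :=
  ∃ s : Finset ((V →ₗ[ℝ] ℝ) × ℝ), E = {x | ∀ p ∈ s, 0 ≤ p.1 x + p.2}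

/-- The recession cone of a set `E`. -/
def recCone (E : Set V) : Set V :=
  {v | ∀ x ∈ E, ∀ t : ℝ, 0 ≤ t → x + t • v ∈ E}

section RecessionCone

omit [FiniteDimensional ℝ V]

/-- The set of nonnegative combinations of the vectors of a finite set. -/
def nonnegSpan (s : Finset V) : Set V :=
  {x | ∃ a : V → ℝ, (∀ v, 0 ≤ a v) ∧ x = ∑ v ∈ s, a v • v}

lemma mem_nonnegSpan_of_nonneg_on {s : Finset V} {a : V → ℝ} (ha : ∀ v ∈ s, 0 ≤ a v) :
    ∑ v ∈ s, a v • v ∈ nonnegSpan s :=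
  ⟨fun v => max (a v) 0, fun _ => le_max_right _ _,
    Finset.sum_congr rfl fun v hv => by simp only [max_eq_left (ha v hv)]⟩

lemma zero_mem_nonnegSpan (s : Finset V) : (0 : V) ∈ nonnegSpan s :=
  ⟨0, fun _ => le_rfl, by simp⟩

lemma add_mem_nonnegSpan {s : Finset V} {x y : V} (hx : x ∈ nonnegSpan s)
    (hy : y ∈ nonnegSpan s) : x + y ∈ nonnegSpan s := by
  obtain ⟨a, ha, rfl⟩ := hx
  obtain ⟨b, hb, rfl⟩ := hy
  exact ⟨a + b, fun v => add_nonneg (ha v) (hb v), by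
    simp [add_smul, Finset.sum_add_distrib]⟩

lemma smul_mem_nonnegSpan {s : Finset V} {x : V} (hx : x ∈ nonnegSpan s) {t : ℝ}
    (ht : 0 ≤ t) : t • x ∈ nonnegSpan s := by
  obtain ⟨a, ha, rfl⟩ := hx
  exact ⟨t • a, fun v => mul_nonneg ht (ha v), by simp [mul_smul, Finset.smul_sum]⟩

lemma nonnegSpan_mono {s t : Finset V} (h : s ⊆ t) : nonnegSpan s ⊆ nonnegSpan t := by
  classical
  rintro x ⟨a, ha, rfl⟩
  refine ⟨fun v => if v ∈ s then a v else 0, fun v => ?_, ?_⟩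
  · dsimp only
    split_ifs
    exacts [ha v, le_rfl]
  · simp only [ite_smul, zero_smul, Finset.sum_ite_mem, Finset.inter_eq_right.2 h]

lemma exists_mem_nonnegSpan_erase [DecidableEq V] {s : Finset V} {g : V → ℝ}
    (hg : ∑ v ∈ s, g v • v = 0) (hpos : ∃ v ∈ s, 0 < g v) {x : V} (hx : x ∈ nonnegSpan s) :
    ∃ v ∈ s, x ∈ nonnegSpan (s.erase v) := by
  obtain ⟨a, ha, rfl⟩ := hx
  obtain ⟨w, hw, hgw⟩ := hpos
  obtain ⟨u, hu, hmin⟩ := (s.filter fun v => 0 < g v).exists_min_image (fun v => a v / g v)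
    ⟨w, Finset.mem_filter.2 ⟨hw, hgw⟩⟩
  obtain ⟨hus, hgu⟩ := Finset.mem_filter.1 hu
  have hnonneg : ∀ v ∈ s, 0 ≤ a v - a u / g u * g v := fun v hv => by
    rcases lt_or_ge 0 (g v) with hgv | hgv
    · exact sub_nonneg.2 ((le_div_iff₀ hgv).1 (hmin v (Finset.mem_filter.2 ⟨hv, hgv⟩)))
    · have := mul_nonpos_of_nonneg_of_nonpos (div_nonneg (ha u) hgu.le) hgv
      linarith [ha v]
  have hsum : ∑ v ∈ s, a v • v = ∑ v ∈ s.erase u, (a v - a u / g u * g v) • v := by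
    rw [Finset.sum_erase s (by simp [div_mul_cancel₀ _ hgu.ne'])]
    simp [sub_smul, mul_smul, Finset.sum_sub_distrib, ← Finset.smul_sum, hg]
  refine ⟨u, hus, ?_⟩
  rw [hsum]
  exact mem_nonnegSpan_of_nonneg_on fun v hv => hnonneg v (Finset.mem_of_mem_erase hv)

lemma isClosed_nonnegSpan_of_linearIndependent {s : Finset V}
    (hs : LinearIndependent ℝ ((↑) : s → V)) : IsClosed (nonnegSpan s) := by
  classical
  have hemb := LinearMap.isClosedEmbedding_of_injective
    (LinearMap.ker_eq_bot.2 hs.fintypeLinearCombination_injective)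
  convert hemb.isClosedMap _ (isClosed_Ici (a := (0 : s → ℝ))) using 1
  ext x
  constructor
  · rintro ⟨a, ha, rfl⟩
    refine ⟨fun v => a v, fun v => ha v, ?_⟩
    rw [Fintype.linearCombination_apply]
    exact Finset.sum_coe_sort s fun v => a v • v
  · rintro ⟨a, ha, rfl⟩
    refine ⟨fun v => if h : v ∈ s then a ⟨v, h⟩ else 0, fun v => ?_, ?_⟩
    · dsimp only
      split_ifs
      exacts [ha _, le_rfl]
    · rw [Fintype.linearCombination_apply, ← Finset.sum_coe_sort s]
      simp

/-- A finitely generated cone is closed: if its generators are linearly dependent, it is the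
union of the cones obtained by deleting one generator. -/
lemma isClosed_nonnegSpan (s : Finset V) : IsClosed (nonnegSpan s) := by
  classical
  induction s using Finset.strongInduction with
  | H s ih =>
    by_cases hs : LinearIndependent ℝ ((↑) : s → V)
    · exact isClosed_nonnegSpan_of_linearIndependent hs
    obtain ⟨g, hg, hpos⟩ : ∃ g : V → ℝ, ∑ v ∈ s, g v • v = 0 ∧ ∃ v ∈ s, 0 < g v := by
      have hs' : ¬ LinearIndepOn ℝ id (s : Set V) := hs
      rw [linearIndepOn_finset_iff] at hs'
      push Not at hs'
      obtain ⟨g, hg, v, hv, hne⟩ := hs'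
      rcases hne.lt_or_gt with h | h
      · exact ⟨-g, by simpa using hg, v, hv, by simpa using h⟩
      · exact ⟨g, hg, v, hv, h⟩
    have hunion : nonnegSpan s = ⋃ v ∈ s, nonnegSpan (s.erase v) := by
      refine Subset.antisymm (fun x hx => ?_)
        (iUnion₂_subset fun v _ => nonnegSpan_mono (s.erase_subset v))
      simpa using exists_mem_nonnegSpan_erase hg hpos hx
    rw [hunion]
    exact isClosed_biUnion_finset fun v hv => ih _ (Finset.erase_ssubset hv)

lemma recCone_add_subset_of_isClosed {B C : Set V} (hBne : B.Nonempty)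
    (hB : Bornology.IsBounded B) (hC : IsClosed C) (h0 : (0 : V) ∈ C)
    (hsmul : ∀ x ∈ C, ∀ t : ℝ, 0 ≤ t → t • x ∈ C) : recCone (B + C) ⊆ C := by
  intro v hv
  obtain ⟨b₀, hb₀⟩ := hBne
  have hdecomp (n : ℕ) : ∃ b ∈ B, ∃ c ∈ C, b + c = b₀ + (n : ℝ) • v := by
    have h := hv (b₀ + 0) (add_mem_add hb₀ h0) n n.cast_nonneg
    rwa [add_zero, mem_add] at h
  choose b hb c hc hbc using hdecomp
  obtain ⟨R, hR⟩ := isBounded_iff_forall_norm_le.1 (hB.sub hB)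
  have hlim : Filter.Tendsto (fun n : ℕ => (n : ℝ)⁻¹ • (b₀ - b n)) Filter.atTop (nhds 0) :=
    (tendsto_inv_atTop_nhds_zero_nat (𝕜 := ℝ)).zero_smul_isBoundedUnder_le
      (Filter.isBoundedUnder_of ⟨R, fun n => hR _ (sub_mem_sub hb₀ (hb n))⟩)
  have hlim' := hlim.add_const v
  rw [zero_add] at hlim'
  refine hC.mem_of_tendsto hlim' ?_
  filter_upwards [Filter.eventually_gt_atTop 0] with n hn
  have hn' : (n : ℝ) ≠ 0 := by positivity
  have hcn : (n : ℝ)⁻¹ • (b₀ - b n) + v = (n : ℝ)⁻¹ • c n := by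
    rw [eq_sub_of_add_eq' (hbc n), add_sub_right_comm, smul_add, inv_smul_smul₀ hn']
  rw [hcn]
  exact hsmul _ (hc n) _ (by positivity)

lemma subset_recCone_add {B C : Set V} (hadd : ∀ x ∈ C, ∀ y ∈ C, x + y ∈ C)
    (hsmul : ∀ x ∈ C, ∀ t : ℝ, 0 ≤ t → t • x ∈ C) : C ⊆ recCone (B + C) := by
  rintro v hv _ ⟨b, hb, c, hc, rfl⟩ t ht
  exact ⟨b, hb, c + t • v, hadd c hc _ (hsmul v hv t ht), (add_assoc b c _).symm⟩

end RecessionCone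

/-- The recession cone of the Minkowski sum of a nonempty compact set and a finitely
generated cone is the cone itself; consequently in any decomposition `E = B + C` of a
polyhedron with `B` nonempty compact and `C` a finitely generated cone, `C` is the
recession cone of `E`. -/
theorem recCone_add_of_compact (B C : Set V)
    (hBne : B.Nonempty) (hBcpt : IsCompact B) (hC : IsFGCone C) :
    recCone (B + C) = C ∧
    ∀ E : Set V, IsPolyhedron E → E = B + C → recCone E = C := by
  obtain ⟨s, rfl⟩ := hC
  have hsmul : ∀ x ∈ nonnegSpan s, ∀ t : ℝ, 0 ≤ t → t • x ∈ nonnegSpan s :=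
    fun _ hx _ ht => smul_mem_nonnegSpan hx ht
  have hrec : recCone (B + nonnegSpan s) = nonnegSpan s :=
    (recCone_add_subset_of_isClosed hBne hBcpt.isBounded (isClosed_nonnegSpan s)
      (zero_mem_nonnegSpan s) hsmul).antisymm
      (subset_recCone_add (fun _ hx _ hy => add_mem_nonnegSpan hx hy) hsmul)
  exact ⟨hrec, fun E _ hE => hE ▸ hrec⟩

end Stmt5
end

section
/- Let K be a field, V a K-vector space, and ι : V × V → ExteriorAlgebra K (V × V) the canonical embedding of V × V into the exterior algebra of V × V. Then for all v, w ∈ V, every element b of the exterior algebra, and every t ∈ K with t ≠ 0, the following identity holds: t · ( ι(v, t·v) * ι(w, t⁻¹·w) * b ) = ι(v, 0) * ι(0, w) * b + t · ( ( ι(v, 0) * ι(w, 0) + ι(0, v) * ι(0, w) ) * b ) + t² · ( ι(0, v) * ι(w, 0) * b ). In particular, the function t ↦ t · ι(v, t·v) * ι(w, t⁻¹·w) * b, defined for t ≠ 0, is given by a polynomial expression in t whose value at t = 0 is ι(v, 0) * ι(0, w) * b. -/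
/-- The key exterior-algebra computation in the proof that the boundary divisor of the
doubling monoid is integral: for `t ≠ 0`,
`t · (ι(v,tv) ∧ ι(w,t⁻¹w) ∧ b)` equals the polynomial expression in `t` whose value at
`t = 0` is `ι(v,0) ∧ ι(0,w) ∧ b`. -/
theorem exterior_algebra_curve_identity
    (K : Type*) [Field K] (V : Type*) [AddCommGroup V] [Module K V]
    (v w : V) (b : ExteriorAlgebra K (V × V)) (t : K) (ht : t ≠ 0) :
    t • (ExteriorAlgebra.ι K ((v, t • v) : V × V) *
         ExteriorAlgebra.ι K ((w, t⁻¹ • w) : V × V) * b)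
      = ExteriorAlgebra.ι K ((v, 0) : V × V) * ExteriorAlgebra.ι K ((0, w) : V × V) * b
        + t • ((ExteriorAlgebra.ι K ((v, 0) : V × V) * ExteriorAlgebra.ι K ((w, 0) : V × V)
              + ExteriorAlgebra.ι K ((0, v) : V × V) * ExteriorAlgebra.ι K ((0, w) : V × V)) * b)
        + t ^ 2 • (ExteriorAlgebra.ι K ((0, v) : V × V) *
                   ExteriorAlgebra.ι K ((w, 0) : V × V) * b) := by
  have split (x y : V) (s : K) : ExteriorAlgebra.ι K ((x, s • y) : V × V)
      = ExteriorAlgebra.ι K ((x, 0) : V × V) + s • ExteriorAlgebra.ι K ((0, y) : V × V) := by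
    rw [← map_smul, ← map_add]
    simp
  rw [split v v t, split w w t⁻¹]
  simp only [add_mul, mul_add, smul_mul_assoc, mul_smul_comm, smul_add, smul_smul,
    mul_inv_cancel₀ ht, inv_mul_cancel₀ ht, one_smul, pow_two]
  abel
end
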